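/- arXiv:1006.0160 — 4 statements merged into one kernel-verified Lean document; each statement's English description precedes it below -/
import Mathlib

section
/- Under the LinDistFlow equations with terminal conditions P_n = Q_n = 0, the voltage drop at node k admits the mutual-impedance representation: for every k = 1, …, n, V_0 − V_k = (1/V_0) · ∑_{m=1}^{n} ( R_{min(m,k)} · p_m + X_{min(m,k)} · q_m ), where R_i = ∑_{j=0}^{i−1} r_j and X_i = ∑_{j=0}^{i−1} x_j are the cumulative resistance and reactance from the substation to node i. -/
theorem ldf_aux (n k : ℕ) (r p P R : ℕ → ℝ)
    (hP : ∀ j < n, P (j + 1) = P j - p (j + 1))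
    (hR : ∀ i, R i = ∑ j ∈ Finset.range i, r j) :
    ∀ N ≤ n, ∑ m ∈ Finset.Icc 1 N, R (min m k) * p m =
      ∑ j ∈ Finset.range (min N k), r j * P j - R (min N k) * P N := by
  intro N
  induction N with
  | zero => intro _; simp [hR]
  | succ N ih =>
    intro h
    rw [Finset.sum_Icc_succ_top (by omega), ih (by omega)]
    have h1 := hP N (by omega)
    have h2 : p (N + 1) = P N - P (N + 1) := by linarith
    rw [h2]
    by_cases hk : N + 1 ≤ k
    · rw [min_eq_left hk, min_eq_left (by omega : N ≤ k), Finset.sum_range_succ]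
      have h3 : R (N + 1) = R N + r N := by rw [hR, hR, Finset.sum_range_succ]
      rw [h3]; ring
    · rw [min_eq_right (by omega : k ≤ N + 1), min_eq_right (by omega : k ≤ N)]
      ring

/-- **Mutual-impedance representation of LinDistFlow voltage drops.**
Radial feeder with nodes `0, …, n`, substation voltage `V 0 > 0`, line
parameters `r j > 0`, `x j > 0`, and net extractions `p m`, `q m` at node `m`.
Under the LinDistFlow recursions with terminal conditions `P n = Q n = 0`,
for every `k = 1, …, n`,
`V 0 - V k = (1 / V 0) * ∑_{m=1}^{n} (R (min m k) * p m + X (min m k) * q m)`,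
where `R i = ∑_{j=0}^{i-1} r j` and `X i = ∑_{j=0}^{i-1} x j` are the
cumulative resistance and reactance from the substation to node `i`. -/
theorem lindistflow_voltage_mutual_impedance
    (n : ℕ) (r x p q P Q V : ℕ → ℝ)
    (hV0 : 0 < V 0)
    (hr : ∀ j < n, 0 < r j) (hx : ∀ j < n, 0 < x j)
    (hP : ∀ j < n, P (j + 1) = P j - p (j + 1))
    (hQ : ∀ j < n, Q (j + 1) = Q j - q (j + 1))
    (hV : ∀ j < n, V (j + 1) = V j - (r j * P j + x j * Q j) / V 0)
    (hPn : P n = 0) (hQn : Q n = 0)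
    (R X : ℕ → ℝ)
    (hR : ∀ i, R i = ∑ j ∈ Finset.range i, r j)
    (hX : ∀ i, X i = ∑ j ∈ Finset.range i, x j) :
    ∀ k, 1 ≤ k → k ≤ n →
      V 0 - V k =
        (1 / V 0) * ∑ m ∈ Finset.Icc 1 n, (R (min m k) * p m + X (min m k) * q m) := by
  intro k _ hk
  have hv : ∀ k ≤ n, V 0 - V k =
      (1 / V 0) * ∑ j ∈ Finset.range k, (r j * P j + x j * Q j) := by
    intro k
    induction k with
    | zero => intro _; simp
    | succ k ih =>
      intro h
      rw [Finset.sum_range_succ, mul_add, ← ih (by omega), hV k (by omega)]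
      ring
  rw [hv k hk, Finset.sum_add_distrib, Finset.sum_add_distrib,
    ldf_aux n k r p P R hP hR n le_rfl, ldf_aux n k x q Q X hQ hX n le_rfl,
    hPn, hQn, min_eq_right hk]
  ring
end

section
/- Suppose the impedance ratio is constant along the feeder, i.e., there exists α > 0 with x_j = α · r_j for every j = 0, …, n−1, and suppose the nodal extractions satisfy the combined-injection condition p_m + α · q_m = 0 for every m = 1, …, n. Then under the LinDistFlow equations with terminal conditions P_n = Q_n = 0, the voltage is perfectly flat: V_k = V_0 for every k = 0, 1, …, n. -/
/-- **Flat voltage profile under the combined-injection condition.**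
Radial feeder with nodes `0, …, n`, substation voltage `V 0 > 0`.  If the
impedance ratio is constant along the feeder (`x j = α * r j` for some
`α > 0` and all `j < n`) and the nodal extractions satisfy
`p m + α * q m = 0` for every `m = 1, …, n`, then under the LinDistFlow
equations with terminal conditions `P n = Q n = 0` the voltage is perfectly
flat: `V k = V 0` for every `k = 0, …, n`. -/
theorem lindistflow_flat_voltage_of_combined_injection
    (n : ℕ) (α : ℝ) (r x p q P Q V : ℕ → ℝ)
    (hα : 0 < α)
    (hV0 : 0 < V 0)
    (hr : ∀ j < n, 0 < r j) (hx : ∀ j < n, 0 < x j)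
    (hxα : ∀ j < n, x j = α * r j)
    (hpq : ∀ m, 1 ≤ m → m ≤ n → p m + α * q m = 0)
    (hP : ∀ j < n, P (j + 1) = P j - p (j + 1))
    (hQ : ∀ j < n, Q (j + 1) = Q j - q (j + 1))
    (hV : ∀ j < n, V (j + 1) = V j - (r j * P j + x j * Q j) / V 0)
    (hPn : P n = 0) (hQn : Q n = 0) :
    ∀ k ≤ n, V k = V 0 := by
  have key : ∀ k ≤ n, P k + α * Q k = P 0 + α * Q 0 := by
    intro k
    induction k with
    | zero => intro _; rfl
    | succ k ih =>
      intro hk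
      rw [hP k (by omega), hQ k (by omega)]
      linear_combination ih (by omega) - hpq (k + 1) (by omega) hk
  have h0 : P 0 + α * Q 0 = 0 := by
    rw [← key n le_rfl, hPn, hQn]; ring
  intro k
  induction k with
  | zero => intro _; rfl
  | succ k ih =>
    intro hk
    have h1 : r k * P k + x k * Q k = 0 := by
      rw [hxα k (by omega)]
      linear_combination r k * (key k (by omega)) + r k * h0
    rw [hV k (by omega), h1, ih (by omega)]
    simp
end

section
/- Suppose there exists α > 0 with x_j = α · r_j for every j = 0, …, n−1, and for a parameter K ∈ ℝ the (unconstrained) hybrid dispatch q_m^{(g)} = q_m^{(c)} + (1 − K)(p_m^{(c)} − p_m^{(g)})/α is applied at every node m = 1, …, n. Then under the LinDistFlow equations with terminal conditions P_n = Q_n = 0, the reactive flows satisfy Q_j = −(1 − K) P_j/α for all j, and the voltage profile satisfies V_0 − V_k = (K/V_0) · ∑_{j=0}^{k−1} r_j P_j for every k = 1, …, n, where P_j = ∑_{m=j+1}^{n} (p_m^{(c)} − p_m^{(g)}); i.e., the voltage drop is exactly K times the drop that occurs under the pure loss-minimizing dispatch K = 1. -/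
/-- **Voltage profile under the unconstrained hybrid dispatch.**
Radial feeder with nodes `0, …, n`, substation voltage `V 0 > 0`,
`x j = α * r j` with `α > 0`.  Net extractions at node `m` are
`pc m - pg m` (real) and `qc m - qg m` (reactive), where the hybrid dispatch
`qg m = qc m + (1 - K) * (pc m - pg m) / α` is applied at every node
`m = 1, …, n`.  Then under the LinDistFlow equations with terminal
conditions `P n = Q n = 0`:
the flows are the downstream sums `P j = ∑_{m=j+1}^{n} (pc m - pg m)`,
the reactive flows satisfy `Q j = -(1 - K) * P j / α`, and the voltage drop
is exactly `K` times the drop of the pure loss-minimizing dispatch: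
`V 0 - V k = (K / V 0) * ∑_{j=0}^{k-1} r j * P j` for `k = 1, …, n`. -/
theorem lindistflow_hybrid_dispatch_voltage_profile
    (n : ℕ) (α K : ℝ) (r x pc pg qc qg P Q V : ℕ → ℝ)
    (hα : 0 < α)
    (hV0 : 0 < V 0)
    (hr : ∀ j < n, 0 < r j) (hx : ∀ j < n, 0 < x j)
    (hxα : ∀ j < n, x j = α * r j)
    (hqg : ∀ m, 1 ≤ m → m ≤ n → qg m = qc m + (1 - K) * (pc m - pg m) / α)
    (hP : ∀ j < n, P (j + 1) = P j - (pc (j + 1) - pg (j + 1)))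
    (hQ : ∀ j < n, Q (j + 1) = Q j - (qc (j + 1) - qg (j + 1)))
    (hV : ∀ j < n, V (j + 1) = V j - (r j * P j + x j * Q j) / V 0)
    (hPn : P n = 0) (hQn : Q n = 0) :
    (∀ j ≤ n, P j = ∑ m ∈ Finset.Icc (j + 1) n, (pc m - pg m)) ∧
    (∀ j ≤ n, Q j = -(1 - K) * P j / α) ∧
    (∀ k, 1 ≤ k → k ≤ n →
      V 0 - V k = (K / V 0) * ∑ j ∈ Finset.range k, r j * P j) := by
  have hPs : ∀ j ≤ n, P j = ∑ m ∈ Finset.Icc (j + 1) n, (pc m - pg m) := by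
    intro j hj
    induction hj using Nat.decreasingInduction with
    | self => simp [hPn]
    | of_succ k hk ih =>
      have h1 := hP k hk
      have h2 := Finset.sum_Ioc_add_eq_sum_Icc (f := fun m => pc m - pg m) (Nat.succ_le_of_lt hk)
      have h3 : Finset.Ioc (k + 1) n = Finset.Icc (k + 1 + 1) n := by
        ext a; simp only [Finset.mem_Ioc, Finset.mem_Icc]; omega
      simp only [Nat.succ_eq_add_one] at h2
      rw [h3] at h2
      linarith
  have hQs : ∀ j ≤ n, Q j = -(1 - K) * P j / α := by
    intro j hj
    induction hj using Nat.decreasingInduction with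
    | self => simp [hPn, hQn]
    | of_succ k hk ih =>
      have h1 := hP k hk
      have h2 := hQ k hk
      have h3 := hqg (k + 1) (by omega) hk
      have h4 : Q k = Q (k + 1) + (qc (k + 1) - qg (k + 1)) := by linarith
      rw [h4, h3, ih, h1]
      ring
  refine ⟨hPs, hQs, ?_⟩
  intro k _ hk
  induction k with
  | zero => simp
  | succ k ih =>
    rcases Nat.eq_zero_or_pos k with h0 | h0
    · subst h0
      rw [hV 0 hk, hxα 0 hk, hQs 0 (by omega)]
      simp only [zero_add, Finset.sum_range_one]
      field_simp
      ring
    · have ih' := ih h0 (by omega)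
      rw [Finset.sum_range_succ, mul_add, ← ih', hV k hk, hxα k hk, hQs k (by omega)]
      field_simp
      ring
end

section
/- Suppose there exists α > 0 with x_j = α · r_j for every j = 0, …, n−1, and for a parameter K ∈ ℝ the (unconstrained) hybrid dispatch q_m^{(g)} = q_m^{(c)} + (1 − K)(p_m^{(c)} − p_m^{(g)})/α is applied at every node. Then with P_j = ∑_{m=j+1}^{n} (p_m^{(c)} − p_m^{(g)}) and Q_j = ∑_{m=j+1}^{n}(q_m^{(c)} − q_m^{(g)}), the total loss equals ℒ(K) = (1 + (1 − K)²/α²) · ∑_{j=0}^{n−1} r_j P_j²/V_0². In particular, ℒ(K) ≥ ℒ(1) for all K ∈ ℝ, so over this one-parameter family the loss is minimized at K = 1. -/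
/-- **Loss of the one-parameter hybrid family is minimized at `K = 1`.**
Radial feeder with nodes `0, …, n`, substation voltage `V0 > 0`,
`x j = α * r j` with `α > 0`.  Under the unconstrained hybrid dispatch
`qg m = qc m + (1 - K) * (pc m - pg m) / α`, the branch flows are
`P j = ∑_{m=j+1}^{n} (pc m - pg m)` and
`Q j = ∑_{m=j+1}^{n} (qc m - qg m)`, and the total loss is
`ℒ K = ∑_{j<n} r j * (P j ^ 2 + Q j ^ 2) / V0 ^ 2`.  Then
`ℒ K = (1 + (1 - K)² / α²) * ∑_{j<n} r j * P j ^ 2 / V0 ^ 2` for every `K`,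
and in particular `ℒ K ≥ ℒ 1` for all `K`, so over this family the loss is
minimized at `K = 1`. -/
theorem hybrid_dispatch_loss_formula_and_min_at_one
    (n : ℕ) (α : ℝ) (V0 : ℝ) (r x pc pg qc : ℕ → ℝ)
    (hα : 0 < α) (hV0 : 0 < V0)
    (hr : ∀ j < n, 0 < r j) (hx : ∀ j < n, 0 < x j)
    (hxα : ∀ j < n, x j = α * r j)
    (P : ℕ → ℝ)
    (hPdef : ∀ j, P j = ∑ m ∈ Finset.Icc (j + 1) n, (pc m - pg m))
    (qg : ℝ → ℕ → ℝ)
    (hqg : ∀ K : ℝ, ∀ m, qg K m = qc m + (1 - K) * (pc m - pg m) / α)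
    (Q : ℝ → ℕ → ℝ)
    (hQdef : ∀ K : ℝ, ∀ j, Q K j = ∑ m ∈ Finset.Icc (j + 1) n, (qc m - qg K m))
    (L : ℝ → ℝ)
    (hL : ∀ K : ℝ,
      L K = ∑ j ∈ Finset.range n, r j * (P j ^ 2 + Q K j ^ 2) / V0 ^ 2) :
    (∀ K : ℝ,
      L K = (1 + (1 - K) ^ 2 / α ^ 2) *
        ∑ j ∈ Finset.range n, r j * P j ^ 2 / V0 ^ 2) ∧
    (∀ K : ℝ, L K ≥ L 1) := by
  have hQ : ∀ K j, Q K j = -((1 - K) / α) * P j := by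
    intro K j
    rw [hQdef, hPdef, Finset.mul_sum]
    refine Finset.sum_congr rfl fun m _ => ?_
    rw [hqg]
    ring
  have hF : ∀ K : ℝ, L K = (1 + (1 - K) ^ 2 / α ^ 2) *
        ∑ j ∈ Finset.range n, r j * P j ^ 2 / V0 ^ 2 := by
    intro K
    rw [hL, Finset.mul_sum]
    refine Finset.sum_congr rfl fun j _ => ?_
    rw [hQ]
    ring
  refine ⟨hF, fun K => ?_⟩
  have hS : 0 ≤ ∑ j ∈ Finset.range n, r j * P j ^ 2 / V0 ^ 2 := by
    refine Finset.sum_nonneg fun j hj => ?_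
    have := hr j (Finset.mem_range.mp hj)
    positivity
  rw [hF K, hF 1]
  refine mul_le_mul_of_nonneg_right ?_ hS
  have : 0 ≤ (1 - K) ^ 2 / α ^ 2 := by positivity
  simpa using this
end
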